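/- arXiv:1112.3813 — 2 statements merged into one kernel-verified Lean document; each statement's English description precedes it below -/
import Mathlib

section
/- Let X and Y be real Banach spaces, G ⊆ X an open set and f : G → Y a function. Then for every separable linear subspace V₀ ⊆ X there exists a closed separable linear subspace V ⊆ X with V₀ ⊆ V such that the following are equivalent: (i) the set of points of G at which f is not Fréchet differentiable is σ-upper porous in X; (ii) the set of points of G ∩ V at which the restriction of f to G ∩ V (regarded as a function on the Banach space V) is not Fréchet differentiable is σ-upper porous in V. -/
open Metric Filter Set Topology TopologicalSpace NNReal ENNReal

/-- `porosityGamma A x R` is the supremum of all radii `r ≥ 0` for which there exists `z`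
with the open ball `U(z,r)` contained in `U(x,R) \ A`. -/
noncomputable def porosityGamma {X : Type*} [MetricSpace X] (A : Set X) (x : X) (R : ℝ) :
    ℝ≥0∞ :=
  ⨆ (r : ℝ≥0) (_ : ∃ z : X, Metric.ball z (r : ℝ) ⊆ Metric.ball x R \ A), (r : ℝ≥0∞)

/-- `A` is upper porous at `x` if `limsup_{R→0+} γ(x,R,A)/R > 0`. -/
def UpperPorousAt {X : Type*} [MetricSpace X] (A : Set X) (x : X) : Prop :=
  0 < Filter.limsup (fun R : ℝ => porosityGamma A x R / ENNReal.ofReal R) (𝓝[>] (0 : ℝ))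

/-- `A` is upper porous if it is upper porous at each of its points. -/
def UpperPorous {X : Type*} [MetricSpace X] (A : Set X) : Prop :=
  ∀ x ∈ A, UpperPorousAt A x

/-- `A` is σ-upper porous if it is a countable union of upper porous sets. -/
def SigmaUpperPorous {X : Type*} [MetricSpace X] (A : Set X) : Prop :=
  ∃ B : ℕ → Set X, (∀ n, UpperPorous (B n)) ∧ A = ⋃ n, B n

/-- `A` has holes of relative size greater than `c` at arbitrarily small scales around `x`. -/
def HasHoles {X : Type*} [MetricSpace X] (c : ℝ) (A : Set X) (x : X) : Prop :=
  ∀ δ > 0, ∃ R, 0 < R ∧ R < δ ∧ ∃ z r, c * R < r ∧ ball z r ⊆ ball x R \ A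

section Porosity

variable {X : Type*} [MetricSpace X]

theorem HasHoles.anti {c d : ℝ} {A B : Set X} {x : X} (h : HasHoles d B x) (hcd : c ≤ d)
    (hAB : A ⊆ B) : HasHoles c A x := by
  intro δ hδ
  obtain ⟨R, hR, hRδ, z, r, hr, hz⟩ := h δ hδ
  exact ⟨R, hR, hRδ, z, r, (mul_le_mul_of_nonneg_right hcd hR.le).trans_lt hr,
    hz.trans (sdiff_subset_sdiff_right hAB)⟩

theorem HasHoles.congr_ball {c ε : ℝ} {A B : Set X} {x : X} (h : HasHoles c B x) (hε : 0 < ε)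
    (hAB : A ∩ ball x ε ⊆ B) : HasHoles c A x := by
  intro δ hδ
  obtain ⟨R, hR, hRδ, z, r, hr, hz⟩ := h (min δ ε) (lt_min hδ hε)
  refine ⟨R, hR, hRδ.trans_le (min_le_left _ _), z, r, hr, fun y hy => ⟨(hz hy).1, fun hyA => ?_⟩⟩
  exact (hz hy).2 (hAB ⟨hyA, ball_subset_ball (hRδ.le.trans (min_le_right _ _)) (hz hy).1⟩)

theorem upperPorousAt_iff {A : Set X} {x : X} :
    UpperPorousAt A x ↔ ∃ c > 0, HasHoles c A x := by
  constructor
  · intro h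
    obtain ⟨c, hc0, hc⟩ := ENNReal.lt_iff_exists_nnreal_btwn.1 h
    have hc0 : 0 < c := by exact_mod_cast hc0
    refine ⟨c, hc0, fun δ hδ => ?_⟩
    have hf := frequently_lt_of_lt_limsup (by isBoundedDefault) hc
    have hev : ∀ᶠ R : ℝ in 𝓝[>] (0 : ℝ), R ∈ Ioo 0 δ := Ioo_mem_nhdsGT hδ
    obtain ⟨R, hR, hR0, hRδ⟩ := (hf.and_eventually hev).exists
    have hpos : ENNReal.ofReal R ≠ 0 := by simpa using hR0
    rw [ENNReal.lt_div_iff_mul_lt (Or.inl hpos) (Or.inl ENNReal.ofReal_ne_top)] at hR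
    simp only [porosityGamma, lt_iSup_iff] at hR
    obtain ⟨r, ⟨z, hz⟩, hr⟩ := hR
    refine ⟨R, hR0, hRδ, z, r, ?_, hz⟩
    have hr' : c * R.toNNReal < r := by
      rw [ENNReal.ofReal] at hr
      exact_mod_cast hr
    have := NNReal.coe_lt_coe.2 hr'
    rwa [NNReal.coe_mul, Real.coe_toNNReal _ hR0.le] at this
  · rintro ⟨c, hc, h⟩
    refine (ENNReal.ofReal_pos.2 hc).trans_le (le_limsup_of_frequently_le ?_ (by isBoundedDefault))
    rw [(nhdsGT_basis (0 : ℝ)).frequently_iff]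
    intro δ hδ
    obtain ⟨R, hR, hRδ, z, r, hr, hz⟩ := h δ hδ
    refine ⟨R, ⟨hR, hRδ⟩, ?_⟩
    have hpos : ENNReal.ofReal R ≠ 0 := by simpa using hR
    rw [ENNReal.le_div_iff_mul_le (Or.inl hpos) (Or.inl ENNReal.ofReal_ne_top),
      ← ENNReal.ofReal_mul hc.le]
    have hr0 : 0 ≤ r := (mul_pos hc hR).le.trans hr.le
    refine (ENNReal.ofReal_le_ofReal hr.le).trans ?_
    exact le_iSup₂_of_le (f := fun (r : ℝ≥0) (_ : ∃ z : X, ball z (r : ℝ) ⊆ ball x R \ A) =>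
      (r : ℝ≥0∞)) r.toNNReal ⟨z, by rwa [Real.coe_toNNReal _ hr0]⟩ le_rfl

theorem UpperPorous.mono {A B : Set X} (hB : UpperPorous B) (h : A ⊆ B) : UpperPorous A := by
  intro x hx
  obtain ⟨c, hc, hh⟩ := upperPorousAt_iff.1 (hB x (h hx))
  exact upperPorousAt_iff.2 ⟨c, hc, hh.anti le_rfl h⟩

theorem SigmaUpperPorous.mono {A B : Set X} (hB : SigmaUpperPorous B) (h : A ⊆ B) :
    SigmaUpperPorous A := by
  obtain ⟨P, hP, rfl⟩ := hB
  refine ⟨fun n => A ∩ P n, fun n => (hP n).mono inter_subset_right, ?_⟩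
  rw [← inter_iUnion, inter_eq_left.2 h]

theorem UpperPorous.sigmaUpperPorous {A : Set X} (hA : UpperPorous A) : SigmaUpperPorous A :=
  ⟨fun _ => A, fun _ => hA, (iUnion_const A).symm⟩

theorem SigmaUpperPorous.iUnion {A : ℕ → Set X} (h : ∀ n, SigmaUpperPorous (A n)) :
    SigmaUpperPorous (⋃ n, A n) := by
  choose P hP hA using h
  refine ⟨fun n => P n.unpair.1 n.unpair.2, fun n => hP _ _, ?_⟩
  rw [iUnion_unpair (fun i j => P i j)]
  exact iUnion_congr hA

theorem SigmaUpperPorous.union {A B : Set X} (hA : SigmaUpperPorous A)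
    (hB : SigmaUpperPorous B) : SigmaUpperPorous (A ∪ B) := by
  refine (SigmaUpperPorous.iUnion (A := fun n => if n = 0 then A else B) fun n => ?_).mono ?_
  · split_ifs
    exacts [hA, hB]
  · rintro x (hx | hx)
    · exact mem_iUnion.2 ⟨0, by simpa using hx⟩
    · exact mem_iUnion.2 ⟨1, by simpa using hx⟩

/-- A locally σ-upper porous set is σ-upper porous, even in a nonseparable space. -/
theorem SigmaUpperPorous.of_local {A : Set X}
    (h : ∀ x ∈ A, ∃ U, IsOpen U ∧ x ∈ U ∧ SigmaUpperPorous (A ∩ U)) : SigmaUpperPorous A := by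
  have h' : ∀ x : A, ∃ U, IsOpen U ∧ x.1 ∈ U ∧ SigmaUpperPorous (A ∩ U) := fun x => h x x.2
  choose U hU hxU hσ using h'
  choose P hP hAP using hσ
  let M : ℕ → A → Set X := fun n a =>
    {y | (∀ b, WellOrderingRel b a → y ∉ U b) ∧ ball y (1 / (n + 1 : ℝ)) ⊆ U a}
  have hsep : ∀ n a b x y, x ∈ M n a → y ∈ M n b → dist y x < 1 / (n + 1 : ℝ) → a = b := by
    intro n a b x y hx hy hd
    rcases trichotomous_of WellOrderingRel a b with hab | hab | hab
    · exact absurd (hx.2 (mem_ball.2 hd)) (hy.1 a hab)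
    · exact hab
    · exact absurd (hy.2 (mem_ball'.2 hd)) (hx.1 b hab)
  have hpor : ∀ n k, UpperPorous (⋃ a, M n a ∩ P a k) := by
    intro n k x hx
    obtain ⟨a, hxM, hxP⟩ := mem_iUnion.1 hx
    obtain ⟨c, hc, hh⟩ := upperPorousAt_iff.1 (hP a k x hxP)
    refine upperPorousAt_iff.2 ⟨c, hc, hh.congr_ball (ε := 1 / (n + 1 : ℝ)) (by positivity) ?_⟩
    rintro y ⟨hy, hyx⟩
    obtain ⟨b, hyM, hyP⟩ := mem_iUnion.1 hy
    rwa [hsep n a b x y hxM hyM hyx]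
  refine (SigmaUpperPorous.iUnion fun n => SigmaUpperPorous.iUnion fun k =>
    (hpor n k).sigmaUpperPorous).mono fun x hx => ?_
  obtain ⟨a, ha, hmin⟩ := (IsWellFounded.wf (r := WellOrderingRel (α := A))).has_min
    {a | x ∈ U a} ⟨⟨x, hx⟩, hxU _⟩
  obtain ⟨ε, hε, hball⟩ := Metric.isOpen_iff.1 (hU a) x ha
  obtain ⟨n, hn⟩ := exists_nat_one_div_lt hε
  have hxa : x ∈ ⋃ k, P a k := hAP a ▸ ⟨hx, ha⟩
  obtain ⟨k, hk⟩ := mem_iUnion.1 hxa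
  exact mem_iUnion.2 ⟨n, mem_iUnion.2 ⟨k, mem_iUnion.2
    ⟨a, ⟨fun b hb hxb => hmin b hxb hb, (ball_subset_ball hn.le).trans hball⟩, hk⟩⟩⟩

/-- No nonempty relatively open part of `S` is σ-upper porous. -/
def NowhereSigmaUpperPorous (S : Set X) : Prop :=
  ∀ U, IsOpen U → (S ∩ U).Nonempty → ¬ SigmaUpperPorous (S ∩ U)

theorem exists_nowhereSigmaUpperPorous_inter_isClosed {A : Set X} (hA : ¬ SigmaUpperPorous A) :
    ∃ C, IsClosed C ∧ (A ∩ C).Nonempty ∧ NowhereSigmaUpperPorous (A ∩ C) := by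
  let C : Set X := {x | ∀ U, IsOpen U → x ∈ U → ¬ SigmaUpperPorous (A ∩ U)}
  have hdiff : SigmaUpperPorous (A \ C) := by
    refine SigmaUpperPorous.of_local fun x hx => ?_
    obtain ⟨U, hU, hxU, hσ⟩ : ∃ U, IsOpen U ∧ x ∈ U ∧ SigmaUpperPorous (A ∩ U) := by
      simpa [C] using hx.2
    exact ⟨U, hU, hxU, hσ.mono (inter_subset_inter_left _ sdiff_subset)⟩
  have hC : IsClosed C := by
    rw [← isOpen_compl_iff, isOpen_iff_forall_mem_open]
    intro x hx
    obtain ⟨U, hU, hxU, hσ⟩ : ∃ U, IsOpen U ∧ x ∈ U ∧ SigmaUpperPorous (A ∩ U) := by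
      simpa [C] using hx
    exact ⟨U, fun y hy hyC => hyC U hU hy hσ, hU, hxU⟩
  refine ⟨C, hC, ?_, fun U hU ⟨x, hx, hxU⟩ hσ => ?_⟩
  · by_contra hne
    rw [not_nonempty_iff_eq_empty] at hne
    exact hA (hdiff.mono fun x hx => ⟨hx, fun hxC => by simpa [hne] using mem_inter hx hxC⟩)
  · refine hx.2 U hU hxU ((hσ.union hdiff).mono ?_)
    rintro y ⟨hyA, hyU⟩
    by_cases hy : y ∈ C
    exacts [Or.inl ⟨⟨hyA, hy⟩, hyU⟩, Or.inr ⟨hyA, hy⟩]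

/-- `S` has no holes of relative size greater than `c` at scales below `δ` around `x`. -/
def NoHoles (c δ : ℝ) (S : Set X) (x : X) : Prop :=
  ∀ R, 0 < R → R < δ → ∀ z r, c * R < r → ¬ ball z r ⊆ ball x R \ S

theorem isClosed_setOf_noHoles {c δ : ℝ} (S : Set X) :
    IsClosed {x | NoHoles c δ S x} := by
  rw [← isOpen_compl_iff, Metric.isOpen_iff]
  intro x hx
  obtain ⟨R, hR, hRδ, z, r, hr, hz⟩ : ∃ R, 0 < R ∧ R < δ ∧ ∃ z r, c * R < r ∧
      ball z r ⊆ ball x R \ S := by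
    simpa [NoHoles] using hx
  have hlim : Tendsto (fun η : ℝ => c * (R + η)) (𝓝[>] 0) (𝓝 (c * (R + 0))) :=
    (Continuous.tendsto (by fun_prop) 0).mono_left nhdsWithin_le_nhds
  rw [add_zero] at hlim
  obtain ⟨η, ⟨h1, h2⟩, h3⟩ := (((hlim.eventually_lt_const hr).and
    (Ioo_mem_nhdsGT (sub_pos.2 hRδ))).and self_mem_nhdsWithin).exists
  refine ⟨η, h3, fun y hy hyN => hyN (R + η) (add_pos hR h3) (by linarith [h2.2]) z r h1 ?_⟩
  refine fun w hw => ⟨?_, (hz hw).2⟩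
  have hwx := mem_ball.1 (hz hw).1
  have hyx := mem_ball'.1 hy
  exact mem_ball.2 ((dist_triangle w x y).trans_lt (add_lt_add hwx hyx))

/-- Inside any part of a nowhere σ-upper porous set `S` there is a smaller such set at whose points
`S` is uniformly far from being porous. -/
theorem NowhereSigmaUpperPorous.exists_noHoles {S : Set X} (hS : NowhereSigmaUpperPorous S)
    {q : X} {ρ c : ℝ} (hc : 0 < c) (hne : (S ∩ ball q ρ).Nonempty) :
    ∃ C, IsClosed C ∧ (S ∩ C).Nonempty ∧ NowhereSigmaUpperPorous (S ∩ C) ∧ C ⊆ closedBall q ρ ∧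
      ∃ δ > 0, ∀ x ∈ C, NoHoles c δ S x := by
  let F : ℕ → Set X := fun n => {x | NoHoles c (1 / (n + 1 : ℝ)) S x}
  have hpor : UpperPorous (S \ ⋃ n, F n) := by
    intro x hx
    refine upperPorousAt_iff.2 ⟨c, hc, fun δ hδ => ?_⟩
    obtain ⟨n, hn⟩ := exists_nat_one_div_lt hδ
    have hxn : x ∉ F n := fun hxn => hx.2 (mem_iUnion.2 ⟨n, hxn⟩)
    obtain ⟨R, hR, hRδ, z, r, hr, hz⟩ : ∃ R, 0 < R ∧ R < 1 / (n + 1 : ℝ) ∧ ∃ z r, c * R < r ∧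
        ball z r ⊆ ball x R \ S := by
      simpa only [F, NoHoles, mem_ofPred_eq, not_forall, not_not, exists_prop] using hxn
    exact ⟨R, hR, hRδ.trans hn, z, r, hr, hz.trans (sdiff_subset_sdiff_right sdiff_subset)⟩
  obtain ⟨n, hn⟩ : ∃ n, ¬ SigmaUpperPorous (S ∩ (closedBall q ρ ∩ F n)) := by
    by_contra! hall
    refine hS _ isOpen_ball hne ((hpor.sigmaUpperPorous.union
      (SigmaUpperPorous.iUnion hall)).mono ?_)
    rintro x ⟨hxS, hxq⟩
    by_cases hx : x ∈ ⋃ n, F n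
    · obtain ⟨n, hn⟩ := mem_iUnion.1 hx
      exact Or.inr (mem_iUnion.2 ⟨n, hxS, ball_subset_closedBall hxq, hn⟩)
    · exact Or.inl ⟨hxS, hx⟩
  obtain ⟨C, hC, hCne, hCσ⟩ := exists_nowhereSigmaUpperPorous_inter_isClosed hn
  rw [inter_assoc] at hCne hCσ
  exact ⟨closedBall q ρ ∩ F n ∩ C, (isClosed_closedBall.inter (isClosed_setOf_noHoles S)).inter hC,
    hCne, hCσ, fun x hx => hx.1.1, 1 / (n + 1 : ℝ), by positivity, fun x hx => hx.1.2⟩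

end Porosity

section SeparableReduction

variable {X M : Type*} [MetricSpace X] [MetricSpace M]

theorem UpperPorous.preimage_isometry {P D : Set X} (hP : UpperPorous P) {e : M → X}
    (he : Isometry e) (hD : range e = closure D)
    (hpick : ∀ q ∈ D, ∀ R r : ℚ, (∃ z, ball z (r : ℝ) ⊆ ball q (R : ℝ) \ P) →
      ∃ z ∈ D, ball z (r : ℝ) ⊆ ball q (R : ℝ) \ P) :
    UpperPorous (e ⁻¹' P) := by
  intro x hx
  obtain ⟨c, hc, hh⟩ := upperPorousAt_iff.1 (hP (e x) hx)
  refine upperPorousAt_iff.2 ⟨c / 2, half_pos hc, fun δ hδ => ?_⟩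
  obtain ⟨R, hR, hRδ, z, r, hr, hz⟩ := hh (δ / 2) (half_pos hδ)
  have hxD : e x ∈ closure D := hD ▸ mem_range_self x
  obtain ⟨q, hqD, hq⟩ := Metric.mem_closure_iff.1 hxD (R / 3) (by positivity)
  obtain ⟨R', hR'1, hR'2⟩ := exists_rat_btwn (show R + R / 3 < R + 2 * (R / 3) by linarith)
  obtain ⟨r', hr'1, hr'2⟩ := exists_rat_btwn hr
  obtain ⟨z', hz'D, hz'⟩ := hpick q hqD R' r' ⟨z, fun w hw => by
    have hw := hz (ball_subset_ball hr'2.le hw)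
    refine ⟨mem_ball.2 ?_, hw.2⟩
    have := mem_ball.1 hw.1
    linarith [dist_triangle w (e x) q]⟩
  obtain ⟨v, rfl⟩ : z' ∈ range e := hD ▸ subset_closure hz'D
  refine ⟨2 * R, by positivity, by linarith, v, r', by linarith, fun w hw => ?_⟩
  have hew : e w ∈ ball (e v) r' := by rwa [mem_ball, he.dist_eq]
  refine ⟨mem_ball.2 ?_, (hz' hew).2⟩
  have := mem_ball.1 (hz' hew).1
  rw [← he.dist_eq]
  linarith [dist_triangle (e w) q (e x), dist_comm q (e x)]

/-- One step of the construction of a point outside a σ-upper porous set: inside a ball centred in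
a member of the family `𝓕` one finds a smaller such ball that avoids a given porous set `Q`. -/
theorem exists_closedBall_avoiding_porous {e : M → X} (he : Isometry e) {𝓕 : Set (Set X)}
    (hpick : ∀ S ∈ 𝓕, ∀ v : M, ∀ r > 0, (S ∩ ball (e v) r).Nonempty →
      ∃ w, e w ∈ S ∧ w ∈ ball v r)
    (hstar : ∀ S ∈ 𝓕, ∀ v : M, ∀ r > 0, (S ∩ ball (e v) r).Nonempty → ∀ c > 0,
      ∃ S' ∈ 𝓕, S'.Nonempty ∧ S' ⊆ S ∩ ball (e v) r ∧ ∃ δ > 0, ∀ x ∈ S', NoHoles c δ S x)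
    {S O : Set X} (hS : S ∈ 𝓕) (hO : IsOpen O) (hSO : S ⊆ O) {v : M} {ρ : ℝ} (hρ : 0 < ρ)
    (hv : e v ∈ S) {Q : Set M} {c : ℝ} (hc : 0 < c) (hQ : ∀ x ∈ Q, HasHoles c Q x)
    {η : ℝ} (hη : 0 < η) :
    ∃ S' ∈ 𝓕, ∃ w ρ', e w ∈ S' ∧ S' ⊆ S ∧ 0 < ρ' ∧ ρ' < η ∧ closedBall w ρ' ⊆ ball v ρ ∧
      closedBall w ρ' ⊆ e ⁻¹' O ∧ ∀ x ∈ closedBall w ρ', e x ∈ S' → x ∉ Q := by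
  have key : ∃ S' ∈ 𝓕, S' ⊆ S ∧ ∃ w ∈ ball v ρ, e w ∈ S' ∧
      ∃ ε > 0, ∀ x ∈ ball w ε, e x ∈ S' → x ∉ Q := by
    by_cases hcase : ∃ w ∈ ball v ρ, e w ∈ S ∧ ∃ ε > 0, ∀ x ∈ ball w ε, e x ∈ S → x ∉ Q
    · exact ⟨S, hS, Subset.rfl, hcase⟩
    push Not at hcase
    obtain ⟨S', hS', hne, hsub, δ, hδ, hholes⟩ :=
      hstar S hS v ρ hρ ⟨e v, hv, mem_ball_self hρ⟩ (c / 2) (half_pos hc)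
    obtain ⟨w, hwS', hw⟩ := hpick S' hS' v ρ hρ
      (hne.mono fun x hx => ⟨hx, (hsub hx).2⟩)
    refine ⟨S', hS', fun x hx => (hsub hx).1, w, hw, hwS', 1, one_pos, fun x _ hxS' hxQ => ?_⟩
    have hxv : dist x v < ρ := by
      have := (hsub hxS').2
      rwa [mem_ball, he.dist_eq] at this
    obtain ⟨R, hR, hRδ, z, r, hr, hz⟩ :=
      hQ x hxQ (min (δ / 2) (ρ - dist x v)) (lt_min (half_pos hδ) (sub_pos.2 hxv))
    have hr0 : 0 < r := (mul_pos hc hR).trans hr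
    have hzx : dist z x < R := (hz (mem_ball_self hr0)).1
    have hrR : r ≤ dist x z := not_lt.1 fun hlt => (hz (mem_ball.2 hlt)).2 hxQ
    refine hholes (e x) hxS' (2 * R) (by positivity) (by linarith [min_le_left (δ / 2) (ρ - dist x v)])
      (e z) r (by linarith) fun y hy => ⟨?_, fun hyS => ?_⟩
    · have := mem_ball.1 hy
      rw [mem_ball]
      linarith [dist_triangle y (e z) (e x), he.dist_eq z x, dist_comm x z]
    · obtain ⟨y', hy'S, hy'⟩ := hpick S hS z r hr0 ⟨y, hyS, hy⟩
      have hy'x := mem_ball.1 (hz hy').1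
      obtain ⟨x', hx', -, hx'Q⟩ := hcase y' (mem_ball.2 (by
        linarith [dist_triangle y' x v, min_le_right (δ / 2) (ρ - dist x v)])) hy'S
        (r - dist y' z) (sub_pos.2 hy')
      refine (hz (mem_ball.2 ?_)).2 hx'Q
      linarith [mem_ball.1 hx', dist_triangle x' y' z]
  obtain ⟨S', hS', hsub, w, hw, hwS', ε, hε, hQε⟩ := key
  have hopen : IsOpen (ball v ρ ∩ e ⁻¹' O ∩ ball w ε) :=
    (isOpen_ball.inter (hO.preimage he.continuous)).inter isOpen_ball
  obtain ⟨ρ₁, hρ₁, hball⟩ := Metric.isOpen_iff.1 hopen w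
    ⟨⟨hw, hSO (hsub hwS')⟩, mem_ball_self hε⟩
  have hmin : 0 < min ρ₁ η := lt_min hρ₁ hη
  have hcl : closedBall w (min ρ₁ η / 2) ⊆ ball v ρ ∩ e ⁻¹' O ∩ ball w ε :=
    (closedBall_subset_ball ((half_lt_self hmin).trans_le (min_le_left _ _))).trans hball
  exact ⟨S', hS', w, min ρ₁ η / 2, hwS', hsub, half_pos hmin,
    (half_lt_self hmin).trans_le (min_le_right _ _), fun x hx => (hcl hx).1.1,
    fun x hx => (hcl hx).1.2, fun x hx => hQε x (hcl hx).2⟩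

/-- A variant of Foran's lemma, along an isometric embedding. -/
theorem not_sigmaUpperPorous_preimage [CompleteSpace M] {e : M → X} (he : Isometry e)
    {𝓕 : Set (Set X)} {A : Set X} {O : ℕ → Set X} (hO : ∀ n, IsOpen (O n)) (hA : A = ⋂ n, O n)
    (hclosed : ∀ S ∈ 𝓕, ∃ C, IsClosed C ∧ S = A ∩ C)
    (hpick : ∀ S ∈ 𝓕, ∀ v : M, ∀ r > 0, (S ∩ ball (e v) r).Nonempty →
      ∃ w, e w ∈ S ∧ w ∈ ball v r)
    (hstar : ∀ S ∈ 𝓕, ∀ v : M, ∀ r > 0, (S ∩ ball (e v) r).Nonempty → ∀ c > 0,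
      ∃ S' ∈ 𝓕, S'.Nonempty ∧ S' ⊆ S ∩ ball (e v) r ∧ ∃ δ > 0, ∀ x ∈ S', NoHoles c δ S x)
    (hne : ∃ S ∈ 𝓕, ∃ v, e v ∈ S) :
    ¬ SigmaUpperPorous (e ⁻¹' A) := by
  rintro ⟨B, hB, hAB⟩
  let Q : ℕ → Set M := fun j =>
    {x ∈ B j.unpair.1 | HasHoles (1 / (j.unpair.2 + 1 : ℝ)) (B j.unpair.1) x}
  have hQ : ∀ j, ∀ x ∈ Q j, HasHoles (1 / (j.unpair.2 + 1 : ℝ)) (Q j) x :=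
    fun j x hx => hx.2.anti le_rfl (sep_subset _ _)
  have hcover : ∀ x, e x ∈ A → ∃ j, x ∈ Q j := by
    intro x hx
    have hx' : x ∈ ⋃ n, B n := hAB ▸ hx
    obtain ⟨n, hn⟩ := mem_iUnion.1 hx'
    obtain ⟨c, hc, hh⟩ := upperPorousAt_iff.1 (hB n x hn)
    obtain ⟨m, hm⟩ := exists_nat_one_div_lt hc
    refine ⟨Nat.pair n m, ?_⟩
    simp only [Q, Nat.unpair_pair, mem_ofPred_eq]
    exact ⟨hn, hh.anti hm.le Subset.rfl⟩
  let State := {s : Set X × M × ℝ // s.1 ∈ 𝓕 ∧ e s.2.1 ∈ s.1 ∧ 0 < s.2.2}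
  have hstep : ∀ (j : ℕ) (s : State), ∃ s' : State, s'.1.1 ⊆ s.1.1 ∧
      s'.1.2.2 < 1 / (j + 1 : ℝ) ∧ closedBall s'.1.2.1 s'.1.2.2 ⊆ closedBall s.1.2.1 s.1.2.2 ∧
      closedBall s'.1.2.1 s'.1.2.2 ⊆ e ⁻¹' O j ∧
      ∀ x ∈ closedBall s'.1.2.1 s'.1.2.2, e x ∈ s'.1.1 → x ∉ Q j := by
    rintro j ⟨⟨S, v, ρ⟩, hS, hv, hρ⟩
    have hSO : S ⊆ O j := by
      obtain ⟨C, -, rfl⟩ := hclosed S hS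
      rw [hA]
      exact fun x hx => mem_iInter.1 hx.1 j
    obtain ⟨S', hS', w, ρ', hw, hsub, hρ', hlt, h1, h2, h3⟩ :=
      exists_closedBall_avoiding_porous he hpick hstar hS (hO j) hSO hρ hv
        (c := 1 / (j.unpair.2 + 1 : ℝ)) (by positivity) (hQ j)
        (η := 1 / (j + 1 : ℝ)) (by positivity)
    exact ⟨⟨⟨S', w, ρ'⟩, hS', hw, hρ'⟩, hsub, hlt, h1.trans ball_subset_closedBall, h2, h3⟩
  choose next hsub hlt hball hOj hQj using hstep
  obtain ⟨S₀, hS₀, v₀, hv₀⟩ := hne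
  let s : ℕ → State := fun n => Nat.rec ⟨⟨S₀, v₀, 1⟩, hS₀, hv₀, one_pos⟩ next n
  have hanti : Antitone fun n => (s n).1.1 := antitone_nat_of_succ_le fun n => hsub n (s n)
  have hantiB : Antitone fun n => closedBall (s n).1.2.1 (s n).1.2.2 :=
    antitone_nat_of_succ_le fun n => hball n (s n)
  have hmem : ∀ i j, i ≤ j → (s j).1.2.1 ∈ closedBall (s i).1.2.1 (s i).1.2.2 :=
    fun i j hij => hantiB hij (mem_closedBall_self (s j).2.2.2.le)
  have hcauchy : CauchySeq fun n => (s (n + 1)).1.2.1 := by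
    refine cauchySeq_of_le_tendsto_0' (fun n => 1 / (n + 1 : ℝ)) (fun n m hnm => ?_)
      tendsto_one_div_add_atTop_nhds_zero_nat
    rw [dist_comm]
    exact (mem_closedBall.1 (hmem _ _ (Nat.succ_le_succ hnm))).trans (hlt n (s n)).le
  obtain ⟨x, hx⟩ := cauchySeq_tendsto_of_complete hcauchy
  have hx' : Tendsto (fun n => (s n).1.2.1) atTop (𝓝 x) := (tendsto_add_atTop_iff_nat 1).1 hx
  have hxball : ∀ j, x ∈ closedBall (s j).1.2.1 (s j).1.2.2 := fun j =>
    isClosed_closedBall.mem_of_tendsto hx' (eventually_atTop.2 ⟨j, fun i hi => hmem j i hi⟩)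
  have hxA : e x ∈ A := by
    rw [hA]
    exact mem_iInter.2 fun j => hOj j (s j) (hxball (j + 1))
  have hxS : ∀ j, e x ∈ (s j).1.1 := by
    intro j
    obtain ⟨C, hC, hSC⟩ := hclosed _ (s j).2.1
    rw [hSC]
    refine ⟨hxA, hC.mem_of_tendsto ((he.continuous.tendsto x).comp hx')
      (eventually_atTop.2 ⟨j, fun i hi => ?_⟩)⟩
    have : e (s i).1.2.1 ∈ (s j).1.1 := hanti hi (s i).2.2.1
    rw [hSC] at this
    exact this.2
  obtain ⟨j, hj⟩ := hcover x hxA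
  exact hQj j (s j) x (hxball (j + 1)) (hxS (j + 1)) hj

end SeparableReduction

section Differentiability

variable {X Y : Type*} [NormedAddCommGroup X] [NormedSpace ℝ X]
  [NormedAddCommGroup Y] [NormedSpace ℝ Y]

/-- A finite configuration of points near `x` on which difference quotients of `f` fail to be
additive up to `1 / (n + 1)`. Such configurations at all scales `1 / (k + 1)`, for one `n`,
witness that `f` is not differentiable at `x`. -/
structure NonDiffWitness (f : X → Y) (n k : ℕ) (t : Fin 3 → ℚ) (x y : X) (p : Fin 3 → X) :
    Prop where
  pos : ∀ i, (0 : ℝ) < t i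
  lt : ∀ i, (t i : ℝ) < 1 / (k + 1)
  near : ∀ i, ‖y - x‖ < 1 / (k + 1) * t i
  bound : ∀ i, ‖p i - y‖ < (n + 1) * t i
  lin : ‖(t 0 : ℝ)⁻¹ • (p 0 - y) - (t 1 : ℝ)⁻¹ • (p 1 - y) - (t 2 : ℝ)⁻¹ • (p 2 - y)‖ <
    1 / (k + 1)
  gap : 1 / (n + 1) < ‖(t 0 : ℝ)⁻¹ • (f (p 0) - f y) - (t 1 : ℝ)⁻¹ • (f (p 1) - f y) -
    (t 2 : ℝ)⁻¹ • (f (p 2) - f y)‖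

theorem DifferentiableAt.exists_not_nonDiffWitness {f : X → Y} {x : X}
    (hf : DifferentiableAt ℝ f x) (n : ℕ) : ∃ k, ∀ t y p, ¬ NonDiffWitness f n k t x y p := by
  obtain ⟨L, hL⟩ := hf
  set N : ℝ := n + 1 with hN
  have hN0 : 0 < N := by positivity
  set η : ℝ := 1 / (6 * N * (N + 2)) with hη
  have hη0 : 0 < η := by positivity
  have hev := (hasFDerivAt_iff_isLittleO.1 hL).def hη0
  obtain ⟨δ, hδ, hδL⟩ := Metric.eventually_nhds_iff.1 hev
  have hm : 0 < min (δ / (N + 1)) (1 / (2 * N * (‖L‖ + 1))) := by positivity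
  obtain ⟨k, hk⟩ := exists_nat_one_div_lt hm
  refine ⟨k, fun t y p w => ?_⟩
  set κ : ℝ := 1 / (k + 1) with hκ
  have hκ0 : 0 < κ := by positivity
  have hκ1 : κ ≤ 1 := by
    rw [hκ, div_le_one (by positivity)]
    linarith [(Nat.cast_nonneg k : (0 : ℝ) ≤ k)]
  have hκδ : (N + 1) * κ < δ := by
    have := hk.trans_le (min_le_left _ _)
    rwa [lt_div_iff₀ (by positivity), mul_comm] at this
  have hκL : ‖L‖ * κ ≤ 1 / (2 * N) := by
    have h := hk.trans_le (min_le_right _ _)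
    rw [lt_div_iff₀ (by positivity)] at h
    rw [le_div_iff₀ (by positivity)]
    nlinarith [norm_nonneg L, mul_pos hκ0 hN0]
  have hrem : ∀ i, ‖(t i : ℝ)⁻¹ • (f (p i) - f y) - L ((t i : ℝ)⁻¹ • (p i - y))‖ ≤
      1 / (6 * N) := by
    intro i
    have ht := w.pos i
    have hy : ‖y - x‖ ≤ t i := (w.near i).le.trans (mul_le_of_le_one_left ht.le hκ1)
    have hp : ‖p i - x‖ ≤ (N + 1) * t i := by
      have : ‖p i - x‖ ≤ ‖p i - y‖ + ‖y - x‖ := norm_sub_le_norm_sub_add_norm_sub _ _ _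
      linarith [w.bound i]
    have htδ : (N + 1) * t i < δ := (mul_lt_mul_of_pos_left (w.lt i) (by positivity)).trans hκδ
    have h1 := hδL (y := y) (by
      rw [dist_eq_norm]
      nlinarith [mul_pos hN0 ht])
    have h2 := hδL (y := p i) (by
      rw [dist_eq_norm]
      exact hp.trans_lt htδ)
    have heq : (t i : ℝ)⁻¹ • (f (p i) - f y) - L ((t i : ℝ)⁻¹ • (p i - y)) =
        (t i : ℝ)⁻¹ • ((f (p i) - f x - L (p i - x)) - (f y - f x - L (y - x))) := by
      rw [map_smul, ← smul_sub]
      congr 1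
      simp only [map_sub]
      abel
    have hle : ‖(f (p i) - f x - L (p i - x)) - (f y - f x - L (y - x))‖ ≤
        η * ((N + 2) * t i) := by
      refine (norm_sub_le _ _).trans ((add_le_add h2 h1).trans ?_)
      rw [← mul_add]
      exact mul_le_mul_of_nonneg_left (by linarith) hη0.le
    rw [heq, norm_smul, norm_inv, Real.norm_of_nonneg ht.le]
    refine (mul_le_mul_of_nonneg_left hle (inv_nonneg.2 ht.le)).trans (le_of_eq ?_)
    rw [hη]
    field_simp
  have hsum : ‖L ((t 0 : ℝ)⁻¹ • (p 0 - y) - (t 1 : ℝ)⁻¹ • (p 1 - y) -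
      (t 2 : ℝ)⁻¹ • (p 2 - y))‖ ≤ 1 / (2 * N) :=
    (L.le_opNorm _).trans ((mul_le_mul_of_nonneg_left w.lin.le (norm_nonneg L)).trans hκL)
  refine absurd w.gap (not_lt.2 ?_)
  set a : Fin 3 → Y := fun i => (t i : ℝ)⁻¹ • (f (p i) - f y) with ha
  set b : Fin 3 → X := fun i => (t i : ℝ)⁻¹ • (p i - y) with hb
  change ‖a 0 - a 1 - a 2‖ ≤ 1 / N
  have hsplit : a 0 - a 1 - a 2 =
      L (b 0 - b 1 - b 2) + (a 0 - L (b 0)) - (a 1 - L (b 1)) - (a 2 - L (b 2)) := by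
    simp only [map_sub]
    abel
  have h3 : 1 / (2 * N) + 1 / (6 * N) + 1 / (6 * N) + 1 / (6 * N) = 1 / N := by
    field_simp
    norm_num
  rw [hsplit, ← h3]
  exact norm_sub_le_of_le (norm_sub_le_of_le (norm_add_le_of_le hsum (hrem 0)) (hrem 1)) (hrem 2)

theorem differentiableAt_of_asymptotically_additive [CompleteSpace Y] {f : X → Y} {x : X}
    (h : ∀ ε > 0, ∀ K : ℝ, ∃ κ > 0, ∀ (t : Fin 3 → ℚ) (u : Fin 3 → X), (∀ i, (0 : ℝ) < t i) →
      (∀ i, (t i : ℝ) < κ) → (∀ i, ‖u i‖ < K) → ‖u 0 - u 1 - u 2‖ < κ →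
      ‖(t 0 : ℝ)⁻¹ • (f (x + (t 0 : ℝ) • u 0) - f x) - (t 1 : ℝ)⁻¹ • (f (x + (t 1 : ℝ) • u 1) - f x)
        - (t 2 : ℝ)⁻¹ • (f (x + (t 2 : ℝ) • u 2) - f x)‖ ≤ ε) :
    DifferentiableAt ℝ f x := by
  let s : ℚ → X → Y := fun t u => (t : ℝ)⁻¹ • (f (x + (t : ℝ) • u) - f x)
  have hs0 : ∀ t, s t 0 = 0 := fun t => by simp [s]
  have hadd : ∀ ε > 0, ∀ K : ℝ, ∃ κ > 0, ∀ (a b c : ℚ) (u v w : X), (0 : ℝ) < a → (0 : ℝ) < b →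
      (0 : ℝ) < c → (a : ℝ) < κ → (b : ℝ) < κ → (c : ℝ) < κ → ‖u‖ < K → ‖v‖ < K → ‖w‖ < K →
      ‖u - v - w‖ < κ → ‖s a u - s b v - s c w‖ ≤ ε := by
    intro ε hε K
    obtain ⟨κ, hκ, H⟩ := h ε hε K
    refine ⟨κ, hκ, fun a b c u v w ha hb hc ha' hb' hc' hu hv hw huvw => ?_⟩
    exact H ![a, b, c] ![u, v, w] (by intro i; fin_cases i <;> assumption)
      (by simp [Fin.forall_fin_succ, *]) (by simp [Fin.forall_fin_succ, *]) (by simpa using huvw)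
  let τ : ℕ → ℚ := fun n => 1 / (n + 1)
  have hτ0 : ∀ n, (0 : ℝ) < τ n := fun n => by simp only [τ]; push_cast; positivity
  have hτ : Tendsto (fun n => (τ n : ℝ)) atTop (𝓝 0) := by
    simpa [τ] using tendsto_one_div_add_atTop_nhds_zero_nat (𝕜 := ℝ)
  have hcauchy : ∀ u, CauchySeq fun n => s (τ n) u := by
    intro u
    refine Metric.cauchySeq_iff'.2 fun ε hε => ?_
    obtain ⟨κ, hκ, H⟩ := hadd (ε / 2) (half_pos hε) (‖u‖ + 1)
    obtain ⟨n₀, hn₀⟩ := eventually_atTop.1 (hτ.eventually_lt_const hκ)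
    refine ⟨n₀, fun n hn => ?_⟩
    have := H (τ n) (τ n₀) (τ n₀) u u 0 (hτ0 _) (hτ0 _) (hτ0 _) (hn₀ n hn) (hn₀ _ le_rfl)
      (hn₀ _ le_rfl) (lt_add_one _) (lt_add_one _) (by simpa using by positivity) (by simpa using hκ)
    rw [hs0, sub_zero] at this
    rw [dist_eq_norm]
    linarith
  choose T hT using fun u => cauchySeq_tendsto_of_complete (hcauchy u)
  have hTadd : ∀ u v, T (u + v) = T u + T v := by
    intro u v
    have hlim := (((hT (u + v)).sub (hT u)).sub (hT v)).norm
    have hle : ‖T (u + v) - T u - T v‖ ≤ 0 := by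
      refine le_of_forall_gt_imp_ge_of_dense fun ε hε => ?_
      obtain ⟨κ, hκ, H⟩ := hadd ε hε (‖u‖ + ‖v‖ + 1)
      refine le_of_tendsto hlim ((hτ.eventually_lt_const hκ).mono fun n hn => ?_)
      exact H _ _ _ _ _ _ (hτ0 n) (hτ0 n) (hτ0 n) hn hn hn (by linarith [norm_add_le u v])
        (by linarith [norm_nonneg v]) (by linarith [norm_nonneg u]) (by simpa using hκ)
    rw [norm_le_zero_iff, sub_sub, sub_eq_zero] at hle
    exact hle
  let TA : X →+ Y := AddMonoidHom.mk' T hTadd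
  have hTcont : Continuous TA := by
    refine continuous_of_continuousAt_zero TA (Metric.continuousAt_iff.2 fun ε hε => ?_)
    obtain ⟨κ, hκ, H⟩ := hadd (ε / 2) (half_pos hε) 1
    refine ⟨min κ 1, lt_min hκ one_pos, fun {u} hu => ?_⟩
    rw [dist_zero_right] at hu
    rw [map_zero, dist_zero_right]
    refine (le_of_tendsto (hT u).norm ?_).trans_lt (half_lt_self hε)
    refine (hτ.eventually_lt_const hκ).mono fun n hn => ?_
    have := H (τ n) (τ n) (τ n) u 0 0 (hτ0 n) (hτ0 n) (hτ0 n) hn hn hn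
      (hu.trans_le (min_le_right _ _)) (by simp) (by simp)
      (by simpa using hu.trans_le (min_le_left _ _))
    simpa [hs0] using this
  let L : X →L[ℝ] Y := TA.toRealLinearMap hTcont
  refine ⟨L, hasFDerivAt_iff_isLittleO_nhds_zero.2 (Asymptotics.isLittleO_iff.2 fun ε hε => ?_)⟩
  obtain ⟨κ, hκ, H⟩ := hadd (ε / 2) (half_pos hε) 1
  refine Metric.eventually_nhds_iff.2 ⟨κ / 2, half_pos hκ, fun u hu => ?_⟩
  rw [dist_zero_right] at hu
  rcases eq_or_ne u 0 with rfl | hu0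
  · simp
  have hu0 : 0 < ‖u‖ := norm_pos_iff.2 hu0
  obtain ⟨t, ht1, ht2⟩ := exists_rat_btwn (show ‖u‖ < 2 * ‖u‖ by linarith)
  have ht : (0 : ℝ) < t := hu0.trans ht1
  set v := (t : ℝ)⁻¹ • u with hv
  have htv : (t : ℝ) • v = u := by rw [hv, smul_inv_smul₀ ht.ne']
  have hv1 : ‖v‖ < 1 := by
    rw [hv, norm_smul, norm_inv, Real.norm_of_nonneg ht.le, inv_mul_lt_iff₀ ht, mul_one]
    exact ht1
  have hle : ‖s t v - T v‖ ≤ ε / 2 := by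
    refine le_of_tendsto ((hT v).const_sub (s t v)).norm
      ((hτ.eventually_lt_const hκ).mono fun n hn => ?_)
    have := H t (τ n) (τ n) v v 0 ht (hτ0 n) (hτ0 n) (by linarith) hn hn hv1 hv1 (by simp)
      (by simpa using hκ)
    simpa [hs0] using this
  have heq : f (x + u) - f x - L u = (t : ℝ) • (s t v - T v) := by
    have hLu : L u = (t : ℝ) • T v := by
      rw [← htv, map_smul]
      rfl
    rw [hLu, smul_sub, smul_inv_smul₀ ht.ne', htv]
  rw [heq, norm_smul, Real.norm_of_nonneg ht.le]
  nlinarith [norm_nonneg (s t v - T v)]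

theorem not_differentiableAt_iff_nonDiffWitness [CompleteSpace Y] {f : X → Y} {x : X} :
    ¬ DifferentiableAt ℝ f x ↔ ∃ n, ∀ k, ∃ t y p, NonDiffWitness f n k t x y p := by
  constructor
  · contrapose!
    intro h
    refine differentiableAt_of_asymptotically_additive fun ε hε K => ?_
    obtain ⟨n₁, hn₁⟩ := exists_nat_one_div_lt hε
    obtain ⟨n₂, hn₂⟩ := exists_nat_gt K
    obtain ⟨k, hk⟩ := h (n₁ + n₂)
    refine ⟨1 / (k + 1), by positivity, fun t u ht htk hu hlin => ?_⟩
    have hc : ∀ i, (t i : ℝ)⁻¹ • (x + (t i : ℝ) • u i - x) = u i := fun i => by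
      rw [add_sub_cancel_left, inv_smul_smul₀ (ht i).ne']
    by_contra hgap
    refine hk t x (fun i => x + (t i : ℝ) • u i) ⟨ht, htk, fun i => ?_, fun i => ?_, ?_, ?_⟩
    · rw [sub_self, norm_zero]
      exact mul_pos (by positivity) (ht i)
    · rw [add_sub_cancel_left, norm_smul, Real.norm_of_nonneg (ht i).le, mul_comm]
      refine mul_lt_mul_of_pos_right ((hu i).trans ?_) (ht i)
      push_cast
      linarith [(Nat.cast_nonneg n₁ : (0 : ℝ) ≤ n₁)]
    · simpa only [hc] using hlin
    · refine lt_of_le_of_lt ?_ ((hn₁.trans (not_le.1 hgap)))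
      refine one_div_le_one_div_of_le (by positivity) ?_
      push_cast
      linarith [(Nat.cast_nonneg n₂ : (0 : ℝ) ≤ n₂)]
  · rintro ⟨n, h⟩ hf
    obtain ⟨k, hk⟩ := hf.exists_not_nonDiffWitness n
    obtain ⟨t, y, p, w⟩ := h k
    exact hk t y p w

theorem NonDiffWitness.eventually {f : X → Y} {n k : ℕ} {t : Fin 3 → ℚ} {x y : X}
    {p : Fin 3 → X} (w : NonDiffWitness f n k t x y p) :
    ∀ᶠ q in 𝓝 x, NonDiffWitness f n k t q y p := by
  have h : ∀ᶠ q in 𝓝 x, ∀ i, ‖y - q‖ < 1 / (k + 1) * t i :=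
    eventually_all.2 fun i => (Continuous.tendsto (f := fun q => ‖y - q‖)
      (by fun_prop) x).eventually_lt_const (w.near i)
  exact h.mono fun q hq => ⟨w.pos, w.lt, hq, w.bound, w.lin, w.gap⟩

theorem isOpen_setOf_nonDiffWitness (f : X → Y) (n k : ℕ) :
    IsOpen {x | ∃ t y p, NonDiffWitness f n k t x y p} := by
  rw [isOpen_iff_eventually]
  rintro x ⟨t, y, p, w⟩
  exact w.eventually.mono fun q hq => ⟨t, y, p, hq⟩

/-- Countably many points assigned to each point suffice to reflect nondifferentiability
of `f` in subspaces. -/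
theorem exists_nonDiffWitness_points (f : X → Y) : ∃ W : X → Set X, (∀ q, (W q).Countable) ∧
    ∀ q n k t, (∃ y p, NonDiffWitness f n k t q y p) →
      ∃ y ∈ W q, ∃ p, (∀ i, p i ∈ W q) ∧ NonDiffWitness f n k t q y p := by
  have h : ∀ q n k t, ∃ y p, (∃ y p, NonDiffWitness f n k t q y p) →
      NonDiffWitness f n k t q y p := by
    intro q n k t
    by_cases hw : ∃ y p, NonDiffWitness f n k t q y p
    · obtain ⟨y, p, w⟩ := hw
      exact ⟨y, p, fun _ => w⟩
    · exact ⟨q, fun _ => q, fun hw' => absurd hw' hw⟩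
  choose y p hyp using h
  refine ⟨fun q => ⋃ (n : ℕ) (k : ℕ) (t : Fin 3 → ℚ), insert (y q n k t) (range (p q n k t)),
    fun q => countable_iUnion fun n => countable_iUnion fun k => countable_iUnion fun t =>
      (countable_range _).insert _, fun q n k t hw => ?_⟩
  have hmem : ∀ z ∈ insert (y q n k t) (range (p q n k t)),
      z ∈ ⋃ (n : ℕ) (k : ℕ) (t : Fin 3 → ℚ), insert (y q n k t) (range (p q n k t)) :=
    fun z hz => mem_iUnion.2 ⟨n, mem_iUnion.2 ⟨k, mem_iUnion.2 ⟨t, hz⟩⟩⟩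
  exact ⟨y q n k t, hmem _ (mem_insert _ _), p q n k t,
    fun i => hmem _ (mem_insert_of_mem _ (mem_range_self i)), hyp q n k t hw⟩

theorem differentiableAt_subspace_iff [CompleteSpace Y] (f : X → Y) {V : Submodule ℝ X}
    {D : Set X} (hVD : (V : Set X) = closure D)
    (hD : ∀ q ∈ D, ∀ n k t, (∃ y p, NonDiffWitness f n k t q y p) →
      ∃ y ∈ D, ∃ p, (∀ i, p i ∈ D) ∧ NonDiffWitness f n k t q y p) (v : V) :
    DifferentiableAt ℝ (fun w : V => f w) v ↔ DifferentiableAt ℝ f (v : X) := by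
  refine ⟨?_, fun h => h.comp v V.subtypeL.differentiableAt⟩
  contrapose
  rw [not_differentiableAt_iff_nonDiffWitness, not_differentiableAt_iff_nonDiffWitness]
  rintro ⟨n, h⟩
  refine ⟨n, fun k => ?_⟩
  obtain ⟨t, y, p, w⟩ := h (2 * k + 1)
  have hκ : (1 : ℝ) / ((2 * k + 1 : ℕ) + 1) = 1 / (k + 1) / 2 := by
    push_cast
    field_simp
    ring
  have hκ0 : (0 : ℝ) < 1 / (k + 1) := by positivity
  have hnear : ∀ᶠ q : X in 𝓝 (v : X), ∀ i, ‖q - v‖ < 1 / (k + 1) / 2 * t i := by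
    refine eventually_all.2 fun i => ?_
    have hlim : Tendsto (fun q : X => ‖q - v‖) (𝓝 (v : X)) (𝓝 ‖(v : X) - v‖) :=
      Continuous.tendsto (by fun_prop) _
    rw [sub_self, norm_zero] at hlim
    exact hlim.eventually_lt_const (mul_pos (half_pos hκ0) (w.pos i))
  have hvD : (v : X) ∈ closure D := hVD ▸ v.2
  obtain ⟨q, hqD, hqw, hqv⟩ :=
    ((mem_closure_iff_frequently.1 hvD).and_eventually (w.eventually.and hnear)).exists
  obtain ⟨y', hy', p', hp', w'⟩ := hD q hqD n (2 * k + 1) t ⟨y, p, hqw⟩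
  have hDV : ∀ z ∈ D, z ∈ V := fun z hz => by
    have : z ∈ (V : Set X) := hVD ▸ subset_closure hz
    exact this
  have hlt := w'.lt
  have hnear' := w'.near
  have hlin := w'.lin
  rw [hκ] at hlt hnear' hlin
  refine ⟨t, ⟨y', hDV y' hy'⟩, fun i => ⟨p' i, hDV _ (hp' i)⟩, w'.pos,
    fun i => (hlt i).trans (half_lt_self hκ0), fun i => ?_, w'.bound,
    hlin.trans (half_lt_self hκ0), w'.gap⟩
  have h1 : ‖y' - v‖ ≤ ‖y' - q‖ + ‖q - v‖ := norm_sub_le_norm_sub_add_norm_sub _ _ _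
  have h2 : ‖y' - v‖ < 1 / (k + 1) * t i := by linarith [hnear' i, hqv i]
  exact h2

end Differentiability

section Subspaces

variable {X : Type*} [NormedAddCommGroup X] [NormedSpace ℝ X]

theorem exists_countable_closed_under {ι : Type*} {D₀ : Set X} (hD₀ : D₀.Countable)
    {I₀ : Set ι} (hI₀ : I₀.Countable) {P : X → ι → Set X} (hP : ∀ x i, (P x i).Countable)
    {Φ : X → ι → Set ι} (hΦ : ∀ x i, (Φ x i).Countable) :
    ∃ (D : Set X) (I : Set ι), D.Countable ∧ D₀ ⊆ D ∧ I₀ ⊆ I ∧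
      (∀ x ∈ D, ∀ y ∈ D, x + y ∈ D) ∧ (∀ q : ℚ, ∀ x ∈ D, (q : ℝ) • x ∈ D) ∧
      (∀ x ∈ D, ∀ i ∈ I, P x i ⊆ D) ∧ ∀ x ∈ D, ∀ i ∈ I, Φ x i ⊆ I := by
  let step : Set X × Set ι → Set X × Set ι := fun s =>
    (s.1 ∪ image2 (· + ·) s.1 s.1 ∪ image2 (fun (q : ℚ) x => (q : ℝ) • x) univ s.1 ∪
      ⋃ x ∈ s.1, ⋃ i ∈ s.2, P x i, s.2 ∪ ⋃ x ∈ s.1, ⋃ i ∈ s.2, Φ x i)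
  let s : ℕ → Set X × Set ι := fun n => step^[n] (D₀, I₀)
  have hs : ∀ n, s (n + 1) = step (s n) := fun n => Function.iterate_succ_apply' step n _
  have hcount : ∀ n, (s n).1.Countable ∧ (s n).2.Countable := by
    intro n
    induction n with
    | zero => exact ⟨hD₀, hI₀⟩
    | succ n ih =>
      rw [hs]
      exact ⟨((ih.1.union (ih.1.image2 ih.1 _)).union (countable_univ.image2 ih.1 _)).union
        (ih.1.biUnion fun x _ => ih.2.biUnion fun i _ => hP x i),
        ih.2.union (ih.1.biUnion fun x _ => ih.2.biUnion fun i _ => hΦ x i)⟩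
  have hmono₁ : Monotone fun n => (s n).1 := monotone_nat_of_le_succ fun n => by
    simp only [hs, step, union_assoc]
    exact subset_union_left
  have hmono₂ : Monotone fun n => (s n).2 := monotone_nat_of_le_succ fun n => by
    simp only [hs, step]
    exact subset_union_left
  have hmemD : ∀ n x, x ∈ (s n).1 → x ∈ ⋃ n, (s n).1 := fun n x hx => mem_iUnion.2 ⟨n, hx⟩
  refine ⟨⋃ n, (s n).1, ⋃ n, (s n).2, countable_iUnion fun n => (hcount n).1,
    subset_iUnion (fun n => (s n).1) 0, subset_iUnion (fun n => (s n).2) 0, ?_, ?_, ?_, ?_⟩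
  · intro x hx y hy
    obtain ⟨n, hn⟩ := mem_iUnion.1 hx
    obtain ⟨m, hm⟩ := mem_iUnion.1 hy
    refine hmemD (max n m + 1) _ ?_
    rw [hs]
    exact Or.inl (Or.inl (Or.inr (mem_image2_of_mem (hmono₁ (le_max_left n m) hn)
      (hmono₁ (le_max_right n m) hm))))
  · intro q x hx
    obtain ⟨n, hn⟩ := mem_iUnion.1 hx
    refine hmemD (n + 1) _ ?_
    rw [hs]
    exact Or.inl (Or.inr ⟨q, mem_univ q, x, hn, rfl⟩)
  · intro x hx i hi z hz
    obtain ⟨n, hn⟩ := mem_iUnion.1 hx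
    obtain ⟨m, hm⟩ := mem_iUnion.1 hi
    refine hmemD (max n m + 1) _ ?_
    rw [hs]
    exact Or.inr (mem_biUnion (hmono₁ (le_max_left n m) hn)
      (mem_biUnion (hmono₂ (le_max_right n m) hm) hz))
  · intro x hx i hi j hj
    obtain ⟨n, hn⟩ := mem_iUnion.1 hx
    obtain ⟨m, hm⟩ := mem_iUnion.1 hi
    refine mem_iUnion.2 ⟨max n m + 1, ?_⟩
    rw [hs]
    exact Or.inr (mem_biUnion (hmono₁ (le_max_left n m) hn)
      (mem_biUnion (hmono₂ (le_max_right n m) hm) hj))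

theorem exists_submodule_coe_eq_closure {D : Set X} (hne : D.Nonempty)
    (hadd : ∀ x ∈ D, ∀ y ∈ D, x + y ∈ D) (hsmul : ∀ q : ℚ, ∀ x ∈ D, (q : ℝ) • x ∈ D) :
    ∃ V : Submodule ℝ X, (V : Set X) = closure D := by
  have hsmul' : ∀ (c : ℝ) {x : X}, x ∈ closure D → c • x ∈ closure D := fun c x hx =>
    map_mem_closure₂ (s := range ((↑) : ℚ → ℝ)) continuous_smul (Rat.denseRange_cast c) hx
      (by rintro _ ⟨q, rfl⟩ y hy; exact hsmul q y hy)
  refine ⟨{ carrier := closure D, add_mem' := ?_, zero_mem' := ?_, smul_mem' := ?_ }, rfl⟩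
  · exact fun hx hy => map_mem_closure₂ continuous_add hx hy hadd
  · obtain ⟨x, hx⟩ := hne
    simpa using hsmul' 0 (subset_closure hx)
  · exact fun c x hx => hsmul' c hx

/-- Every separable subspace is contained in a closed separable subspace with a dense subset closed
under prescribed operations with countably many values. -/
theorem exists_separable_subspace_closed_under {ι : Type*} {V₀ : Submodule ℝ X}
    (hV₀ : IsSeparable (V₀ : Set X)) (i₀ : ι) {P : X → ι → Set X}
    (hP : ∀ x i, (P x i).Countable) {Φ : X → ι → Set ι} (hΦ : ∀ x i, (Φ x i).Countable) :
    ∃ (V : Submodule ℝ X) (D : Set X) (I : Set ι), IsClosed (V : Set X) ∧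
      IsSeparable (V : Set X) ∧ V₀ ≤ V ∧ (V : Set X) = closure D ∧ D.Nonempty ∧ i₀ ∈ I ∧
      (∀ x ∈ D, ∀ i ∈ I, P x i ⊆ D) ∧ ∀ x ∈ D, ∀ i ∈ I, Φ x i ⊆ I := by
  obtain ⟨D₀, hD₀, hVD₀⟩ := hV₀
  obtain ⟨D, I, hD, hD₀D, hI, hadd, hsmul, hPD, hΦI⟩ :=
    exists_countable_closed_under hD₀ (countable_singleton i₀) hP hΦ
  have hne : D.Nonempty := by
    have h0 : (0 : X) ∈ closure D₀ := hVD₀ V₀.zero_mem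
    exact (closure_nonempty_iff.1 ⟨0, h0⟩).mono hD₀D
  obtain ⟨V, hV⟩ := exists_submodule_coe_eq_closure hne hadd hsmul
  refine ⟨V, D, I, hV ▸ isClosed_closure, hV ▸ hD.isSeparable.closure, ?_, hV, hne,
    hI rfl, hPD, hΦI⟩
  rw [← SetLike.coe_subset_coe, hV]
  exact hVD₀.trans (closure_mono hD₀D)

theorem exists_subspace_sigmaUpperPorous_preimage {A : Set X} (hA : SigmaUpperPorous A)
    {V₀ : Submodule ℝ X} (hV₀ : IsSeparable (V₀ : Set X)) {W : X → Set X}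
    (hW : ∀ q, (W q).Countable) :
    ∃ (V : Submodule ℝ X) (D : Set X), IsClosed (V : Set X) ∧ IsSeparable (V : Set X) ∧ V₀ ≤ V ∧
      (V : Set X) = closure D ∧ (∀ q ∈ D, W q ⊆ D) ∧
      SigmaUpperPorous ((↑) ⁻¹' A : Set V) := by
  obtain ⟨B, hB, rfl⟩ := hA
  have hpick : ∀ (q : X) (n : ℕ) (R r : ℚ), ∃ z, (∃ z, ball z (r : ℝ) ⊆ ball q (R : ℝ) \ B n) →
      ball z (r : ℝ) ⊆ ball q (R : ℝ) \ B n := by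
    intro q n R r
    by_cases h : ∃ z, ball z (r : ℝ) ⊆ ball q (R : ℝ) \ B n
    · exact h.imp fun z hz _ => hz
    · exact ⟨q, fun h' => absurd h' h⟩
  choose z hz using hpick
  obtain ⟨V, D, I, hcl, hsep, hle, hVD, -, hI, hP, -⟩ :=
    exists_separable_subspace_closed_under (ι := Unit) hV₀ ()
      (P := fun q _ => W q ∪ range fun a : ℕ × ℚ × ℚ => z q a.1 a.2.1 a.2.2)
      (fun q _ => (hW q).union (countable_range _)) (Φ := fun _ _ => ∅)
      (fun _ _ => countable_empty)
  refine ⟨V, D, hcl, hsep, hle, hVD, fun q hq => subset_union_left.trans (hP q hq () hI),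
    fun n => (↑) ⁻¹' B n, fun n => ?_, preimage_iUnion⟩
  refine (hB n).preimage_isometry (D := D) (e := ((↑) : V → X)) isometry_subtype_coe ?_ ?_
  · rw [← hVD]
    exact Subtype.range_coe
  · exact fun q hq R r h => ⟨z q n R r,
      hP q hq () hI (Or.inr (mem_range_self (n, R, r))), hz q n R r h⟩

theorem exists_subspace_not_sigmaUpperPorous_preimage [CompleteSpace X] {A : Set X}
    (hA : ¬ SigmaUpperPorous A) {O : ℕ → Set X} (hO : ∀ n, IsOpen (O n)) (hAO : A = ⋂ n, O n)
    {V₀ : Submodule ℝ X} (hV₀ : IsSeparable (V₀ : Set X)) {W : X → Set X}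
    (hW : ∀ q, (W q).Countable) :
    ∃ (V : Submodule ℝ X) (D : Set X), IsClosed (V : Set X) ∧ IsSeparable (V : Set X) ∧ V₀ ≤ V ∧
      (V : Set X) = closure D ∧ (∀ q ∈ D, W q ⊆ D) ∧
      ¬ SigmaUpperPorous ((↑) ⁻¹' A : Set V) := by
  let ι := {S : Set X // (∃ C, IsClosed C ∧ S = A ∩ C) ∧ S.Nonempty ∧ NowhereSigmaUpperPorous S}
  have hstar : ∀ (q : X) (S : ι) (r : ℚ) (m : ℕ), ∃ S' : ι, (S.1 ∩ ball q (r : ℝ)).Nonempty →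
      S'.1 ⊆ S.1 ∩ closedBall q (r : ℝ) ∧
      ∃ δ > 0, ∀ x ∈ S'.1, NoHoles (1 / (m + 1 : ℝ)) δ S.1 x := by
    rintro q ⟨S, ⟨C₀, hC₀, rfl⟩, hne, hσ⟩ r m
    by_cases h : (A ∩ C₀ ∩ ball q (r : ℝ)).Nonempty
    · obtain ⟨C, hC, hCne, hCσ, hCq, δ, hδ, hholes⟩ :=
        hσ.exists_noHoles (c := 1 / (m + 1 : ℝ)) (by positivity) h
      exact ⟨⟨A ∩ C₀ ∩ C, ⟨C₀ ∩ C, hC₀.inter hC, inter_assoc _ _ _⟩, hCne, hCσ⟩, fun _ =>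
        ⟨inter_subset_inter_right _ hCq, δ, hδ, fun x hx => hholes x hx.2⟩⟩
    · exact ⟨⟨A ∩ C₀, ⟨C₀, hC₀, rfl⟩, hne, hσ⟩, fun h' => absurd h' h⟩
  have hpick : ∀ (q : X) (S : ι) (r : ℚ), ∃ p, (S.1 ∩ ball q (r : ℝ)).Nonempty →
      p ∈ S.1 ∩ ball q (r : ℝ) := by
    intro q S r
    by_cases h : (S.1 ∩ ball q (r : ℝ)).Nonempty
    · exact h.imp fun p hp _ => hp
    · exact ⟨q, fun h' => absurd h' h⟩
  choose star hstar using hstar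
  choose pick hpick using hpick
  obtain ⟨C, hC, hCne, hCσ⟩ := exists_nowhereSigmaUpperPorous_inter_isClosed hA
  obtain ⟨V, D, I, hcl, hsep, hle, hVD, hDne, hI, hP, hΦ⟩ :=
    exists_separable_subspace_closed_under (ι := ι) hV₀ ⟨A ∩ C, ⟨C, hC, rfl⟩, hCne, hCσ⟩
      (P := fun q S => W q ∪ range fun r : ℚ => pick q S r)
      (fun q _ => (hW q).union (countable_range _))
      (Φ := fun q S => range fun a : ℚ × ℕ => star q S a.1 a.2)
      (fun _ _ => countable_range _)
  have hDV : ∀ q ∈ D, ∃ w : V, (w : X) = q := fun q hq => by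
    have : q ∈ (V : Set X) := hVD ▸ subset_closure hq
    exact ⟨⟨q, this⟩, rfl⟩
  have happrox : ∀ (S : Set X) (v : V), ∀ r > 0, (S ∩ ball (v : X) r).Nonempty →
      ∃ q ∈ D, ∃ r' : ℚ, (S ∩ ball q (r' : ℝ)).Nonempty ∧
        closedBall q (r' : ℝ) ⊆ ball (v : X) r := by
    rintro S v r hr ⟨x, hxS, hx⟩
    have hx := mem_ball.1 hx
    have hvD : (v : X) ∈ closure D := hVD ▸ v.2
    obtain ⟨q, hqD, hq⟩ := Metric.mem_closure_iff.1 hvD ((r - dist x v) / 3) (by linarith)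
    obtain ⟨r', hr'1, hr'2⟩ := exists_rat_btwn
      (show dist x v + (r - dist x v) / 3 < r - (r - dist x v) / 3 by linarith)
    refine ⟨q, hqD, r', ⟨x, hxS, mem_ball.2 ?_⟩, fun y hy => mem_ball.2 ?_⟩
    · linarith [dist_triangle x v q]
    · linarith [mem_closedBall.1 hy, dist_triangle y q v, dist_comm q (v : X)]
  have : CompleteSpace V := hcl.completeSpace_coe
  refine ⟨V, D, hcl, hsep, hle, hVD, fun q hq => subset_union_left.trans (hP q hq _ hI), ?_⟩
  have hpickV : ∀ S ∈ image Subtype.val I, ∀ v : V, ∀ r > 0, (S ∩ ball (v : X) r).Nonempty →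
      ∃ w : V, (w : X) ∈ S ∧ w ∈ ball v r := by
    rintro _ ⟨S, hS, rfl⟩ v r hr hne
    obtain ⟨q, hqD, r', hne', hsub⟩ := happrox _ v r hr hne
    obtain ⟨w, hw⟩ := hDV _ (hP q hqD S hS (Or.inr (mem_range_self r')))
    have hp := hpick q S r' hne'
    rw [← hw] at hp
    exact ⟨w, hp.1, hsub (ball_subset_closedBall hp.2)⟩
  refine not_sigmaUpperPorous_preimage (𝓕 := image Subtype.val I) isometry_subtype_coe hO hAO ?_
    hpickV ?_ ?_
  · rintro _ ⟨S, -, rfl⟩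
    exact S.2.1
  · rintro _ ⟨S, hS, rfl⟩ v r hr hne c hc
    obtain ⟨q, hqD, r', hne', hsub⟩ := happrox _ v r hr hne
    obtain ⟨m, hm⟩ := exists_nat_one_div_lt hc
    obtain ⟨hsub', δ, hδ, hholes⟩ := hstar q S r' m hne'
    refine ⟨_, mem_image_of_mem _ (hΦ q hqD S hS (mem_range_self (r', m))), (star q S r' m).2.2.1,
      hsub'.trans (inter_subset_inter_right _ hsub), δ, hδ, fun x hx R hR hRδ z s hs => ?_⟩
    exact hholes x hx R hR hRδ z s ((mul_le_mul_of_nonneg_right hm.le hR.le).trans_lt hs)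
  · refine ⟨_, mem_image_of_mem _ hI, ?_⟩
    obtain ⟨x, hx⟩ := hCne
    obtain ⟨w, hw, -⟩ := hpickV _ (mem_image_of_mem _ hI) 0 (dist x 0 + 1) (by positivity)
      ⟨x, hx, mem_ball.2 (by simp)⟩
    exact ⟨w, hw⟩

end Subspaces

/-- σ-upper porosity of the set of points of non-Fréchet-differentiability is separably
determined. -/
theorem sigmaUpperPorous_nonFrechetDiff_separably_determined
    {X Y : Type*} [NormedAddCommGroup X] [NormedSpace ℝ X] [CompleteSpace X]
    [NormedAddCommGroup Y] [NormedSpace ℝ Y] [CompleteSpace Y]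
    (G : Set X) (hG : IsOpen G) (f : X → Y)
    (V₀ : Subspace ℝ X) (hV₀ : TopologicalSpace.IsSeparable (V₀ : Set X)) :
    ∃ V : Subspace ℝ X, IsClosed (V : Set X) ∧ TopologicalSpace.IsSeparable (V : Set X) ∧
      V₀ ≤ V ∧
      (SigmaUpperPorous {x : X | x ∈ G ∧ ¬ DifferentiableAt ℝ f x} ↔
        SigmaUpperPorous
          {v : V | (v : X) ∈ G ∧ ¬ DifferentiableAt ℝ (fun w : V => f (w : X)) v}) := by
  obtain ⟨W, hW, hWf⟩ := exists_nonDiffWitness_points f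
  have hdiff : ∀ (V : Submodule ℝ X) (D : Set X), (V : Set X) = closure D →
      (∀ q ∈ D, W q ⊆ D) →
      {v : V | (v : X) ∈ G ∧ ¬ DifferentiableAt ℝ (fun w : V => f (w : X)) v} =
        (↑) ⁻¹' {x : X | x ∈ G ∧ ¬ DifferentiableAt ℝ f x} := by
    intro V D hVD hWD
    ext v
    refine and_congr_right fun _ => not_congr (differentiableAt_subspace_iff f hVD ?_ v)
    intro q hq n k t hw
    obtain ⟨y, hy, p, hp, w⟩ := hWf q n k t hw
    exact ⟨y, hWD q hq hy, p, fun i => hWD q hq (hp i), w⟩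
  by_cases hσ : SigmaUpperPorous {x : X | x ∈ G ∧ ¬ DifferentiableAt ℝ f x}
  · obtain ⟨V, D, hcl, hsep, hle, hVD, hWD, hV⟩ :=
      exists_subspace_sigmaUpperPorous_preimage hσ hV₀ hW
    refine ⟨V, hcl, hsep, hle, ?_⟩
    rw [hdiff V D hVD hWD]
    exact iff_of_true hσ hV
  · let A : ℕ → Set X := fun n => ⋂ k, G ∩ {x | ∃ t y p, NonDiffWitness f n k t x y p}
    have hA : {x : X | x ∈ G ∧ ¬ DifferentiableAt ℝ f x} = ⋃ n, A n := by
      ext x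
      simp only [A, ← inter_iInter, ← inter_iUnion]
      refine and_congr_right fun _ => ?_
      simp only [not_differentiableAt_iff_nonDiffWitness, mem_iUnion, mem_iInter, mem_ofPred_eq]
    obtain ⟨n, hn⟩ : ∃ n, ¬ SigmaUpperPorous (A n) := by
      by_contra! hall
      exact hσ (hA ▸ SigmaUpperPorous.iUnion hall)
    obtain ⟨V, D, hcl, hsep, hle, hVD, hWD, hV⟩ :=
      exists_subspace_not_sigmaUpperPorous_preimage hn
        (fun k => hG.inter (isOpen_setOf_nonDiffWitness f n k)) rfl hV₀ hW
    refine ⟨V, hcl, hsep, hle, ?_⟩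
    rw [hdiff V D hVD hWD]
    refine iff_of_false hσ fun h => hV (h.mono (preimage_mono ?_))
    rw [hA]
    exact subset_iUnion A n
end

section
/- Let X be a metric space and A ⊆ X. Then A is σ-upper porous if and only if A is σ-3-porous, i.e., σ-⟨g⟩-porous for the porosity function g(x) = 3x. -/
open Metric Filter Set Topology TopologicalSpace NNReal ENNReal

/-- `A` is `⟨g⟩`-porous at `x` (for a porosity function `g` defined on all of `[0,∞)`) if there
are sequences of centers `c n` and radii `r n > 0` with `c n → x`, `U(c n, r n) ∩ A = ∅` and
`x ∈ U(c n, g (r n))` for each `n`. -/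
def GPorousAt {X : Type*} [MetricSpace X] (g : ℝ → ℝ) (A : Set X) (x : X) : Prop :=
  ∃ (c : ℕ → X) (r : ℕ → ℝ), Filter.Tendsto c Filter.atTop (nhds x) ∧
    ∀ n, 0 < r n ∧ Metric.ball (c n) (r n) ∩ A = ∅ ∧ x ∈ Metric.ball (c n) (g (r n))

/-- `A` is `⟨g⟩`-porous if it is `⟨g⟩`-porous at each of its points. -/
def GPorous {X : Type*} [MetricSpace X] (g : ℝ → ℝ) (A : Set X) : Prop :=
  ∀ x ∈ A, GPorousAt g A x

/-- `A` is σ-`⟨g⟩`-porous if it is a countable union of `⟨g⟩`-porous sets. -/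
def SigmaGPorous {X : Type*} [MetricSpace X] (g : ℝ → ℝ) (A : Set X) : Prop :=
  ∃ B : ℕ → Set X, (∀ n, GPorous g (B n)) ∧ A = ⋃ n, B n

theorem gPorousAt_iff {X : Type*} [MetricSpace X] {g : ℝ → ℝ} {A : Set X} {x : X} :
    GPorousAt g A x ↔ ∀ δ > 0, ∃ (c : X) (r : ℝ), dist c x < δ ∧ 0 < r ∧
      ball c r ∩ A = ∅ ∧ dist x c < g r := by
  constructor
  · rintro ⟨c, r, hc, h⟩ δ hδ
    obtain ⟨n, hn⟩ := (Metric.tendsto_atTop.1 hc) δ hδ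
    exact ⟨c n, r n, hn n le_rfl, h n⟩
  · intro h
    choose c r hc hr using fun n : ℕ => h (1 / ((n : ℝ) + 1)) Nat.one_div_pos_of_nat
    refine ⟨c, r, tendsto_iff_dist_tendsto_zero.2 ?_, hr⟩
    exact squeeze_zero (fun _ => dist_nonneg) (fun n => (hc n).le)
      tendsto_one_div_add_atTop_nhds_zero_nat

theorem GPorousAt.mono {X : Type*} [MetricSpace X] {g : ℝ → ℝ} {A B : Set X} {x : X}
    (h : GPorousAt g A x) (hBA : B ⊆ A) : GPorousAt g B x := by
  obtain ⟨c, r, hc, hr⟩ := h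
  refine ⟨c, r, hc, fun n => ⟨(hr n).1, ?_, (hr n).2.2⟩⟩
  exact subset_empty_iff.1 ((inter_subset_inter_right _ hBA).trans (hr n).2.1.subset)

theorem GPorous.sigmaGPorous {X : Type*} [MetricSpace X] {g : ℝ → ℝ} {A : Set X}
    (h : GPorous g A) : SigmaGPorous g A :=
  ⟨fun _ => A, fun _ => h, (iUnion_const A).symm⟩

theorem SigmaGPorous.iUnion {X : Type*} [MetricSpace X] {g : ℝ → ℝ} {ι : Type*} [Countable ι]
    [Nonempty ι] {A : ι → Set X} (h : ∀ i, SigmaGPorous g (A i)) :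
    SigmaGPorous g (⋃ i, A i) := by
  choose B hB hA using h
  obtain ⟨f, hf⟩ := exists_surjective_nat (ι × ℕ)
  refine ⟨fun n => B (f n).1 (f n).2, fun n => hB _ _, ?_⟩
  rw [hf.iUnion_comp (fun p : ι × ℕ => B p.1 p.2), iUnion_prod']
  exact iUnion_congr hA

/-- Points `x` such that every ball missing `B` whose center `c` is `δ`-close to `x` has radius at
most `dist x c / 3`. -/
def farFromHoles {X : Type*} [MetricSpace X] (B : Set X) (δ : ℝ) : Set X :=
  {x ∈ B | ∀ (c : X) (r : ℝ), dist c x < δ → 0 < r → ball c r ∩ B = ∅ → 3 * r ≤ dist x c}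

/-- Passing to `farFromHoles B δ` triples the radius of small holes. -/
theorem GPorous.farFromHoles {X : Type*} [MetricSpace X] {B : Set X} {K δ : ℝ}
    (h : GPorous (fun t => K * 3 * t) B) (hδ : 0 < δ) :
    GPorous (fun t => K * t) (farFromHoles B δ) := by
  intro x hx
  refine gPorousAt_iff.2 fun η hη => ?_
  obtain ⟨c, r, hcx, hr, hB, hxc⟩ := gPorousAt_iff.1 (h x hx.1) (min δ η) (lt_min hδ hη)
  refine ⟨c, 3 * r, hcx.trans_le (min_le_right _ _), by positivity, ?_, by linarith⟩
  refine eq_empty_of_forall_notMem fun y ⟨hyc, hy⟩ => ?_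
  have hx3 := hx.2 c r (hcx.trans_le (min_le_left _ _)) hr hB
  have hyδ : dist c y < δ := by
    rw [mem_ball, dist_comm] at hyc
    rw [dist_comm] at hx3
    exact hyc.trans_le (hx3.trans (hcx.le.trans (min_le_left _ _)))
  exact (mem_ball.1 hyc).not_ge (hy.2 c r hyδ hr hB)

theorem sigmaGPorous_three_of_gPorous_pow {X : Type*} [MetricSpace X] (n : ℕ) :
    ∀ B : Set X, GPorous (fun t => 3 ^ n * t) B → SigmaGPorous (fun t => 3 * t) B := by
  induction n with
  | zero =>
    refine fun B h => GPorous.sigmaGPorous fun x hx => ?_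
    obtain ⟨c, r, hc, hr⟩ := h x hx
    refine ⟨c, r, hc, fun n => ⟨(hr n).1, (hr n).2.1, ball_subset_ball ?_ (hr n).2.2⟩⟩
    have := (hr n).1
    norm_num
    linarith
  | succ n ih =>
    intro B h
    let S : Option ℕ → Set X := fun o =>
      o.elim {x ∈ B | GPorousAt (fun t => 3 * t) B x} fun m => farFromHoles B (1 / ((m : ℝ) + 1))
    have hS : B = ⋃ o, S o := by
      refine Subset.antisymm (fun x hx => ?_) (iUnion_subset fun o => ?_)
      · by_cases hg : GPorousAt (fun t => 3 * t) B x
        · exact mem_iUnion.2 ⟨none, hx, hg⟩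
        · rw [gPorousAt_iff] at hg
          push Not at hg
          obtain ⟨δ, hδ, hfar⟩ := hg
          obtain ⟨m, hm⟩ := exists_nat_one_div_lt hδ
          exact mem_iUnion.2 ⟨some m, hx, fun c r hc => hfar c r (hc.trans hm)⟩
      · cases o <;> exact sep_subset _ _
    rw [hS]
    refine SigmaGPorous.iUnion fun o => ?_
    cases o with
    | none => exact GPorous.sigmaGPorous fun x hx => hx.2.mono (sep_subset _ _)
    | some m =>
      simp only [pow_succ] at h
      exact ih _ (h.farFromHoles Nat.one_div_pos_of_nat)

theorem UpperPorousAt.exists_gPorousAt_pow {X : Type*} [MetricSpace X] {A : Set X} {x : X}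
    (h : UpperPorousAt A x) : ∃ n : ℕ, GPorousAt (fun t => 3 ^ n * t) A x := by
  obtain ⟨ε, hε, hlim⟩ := ENNReal.lt_iff_exists_nnreal_btwn.1 h
  have hε' : (0 : ℝ) < ε := by exact_mod_cast hε
  obtain ⟨n, hn⟩ := pow_unbounded_of_one_lt (ε : ℝ)⁻¹ (by norm_num : (1 : ℝ) < 3)
  refine ⟨n, gPorousAt_iff.2 fun δ hδ => ?_⟩
  obtain ⟨R, hR, hR0, hRδ⟩ :=
    ((frequently_lt_of_lt_limsup (by isBoundedDefault) hlim).and_eventually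
      (Ioo_mem_nhdsGT hδ)).exists
  have hlt : (ε : ℝ≥0∞) * ENNReal.ofReal R < porosityGamma A x R :=
    (ENNReal.lt_div_iff_mul_lt (by simp [hR0]) (by simp)).1 hR
  obtain ⟨r, hr⟩ := lt_iSup_iff.1 hlt
  obtain ⟨⟨z, hz⟩, hr⟩ := lt_iSup_iff.1 hr
  have hεr : (ε : ℝ) * R < r := by
    rw [ENNReal.ofReal, ← ENNReal.coe_mul, ENNReal.coe_lt_coe, ← NNReal.coe_lt_coe] at hr
    simpa [hR0.le] using hr
  have hr0 : (0 : ℝ) < r := (mul_pos hε' hR0).trans hεr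
  have hzx : dist z x < R := (hz (mem_ball_self hr0)).1
  refine ⟨z, r, hzx.trans hRδ, hr0, ?_, ?_⟩
  · exact eq_empty_of_forall_notMem fun y hy => (hz hy.1).2 hy.2
  · calc dist x z < R := by rwa [dist_comm]
      _ < (ε : ℝ)⁻¹ * r := by rwa [lt_inv_mul_iff₀ hε']
      _ ≤ 3 ^ n * r := by gcongr

theorem UpperPorous.sigmaGPorous_three {X : Type*} [MetricSpace X] {A : Set X}
    (h : UpperPorous A) : SigmaGPorous (fun t => 3 * t) A := by
  have hA : A = ⋃ n : ℕ, {x ∈ A | GPorousAt (fun t => 3 ^ n * t) A x} := by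
    refine Subset.antisymm (fun x hx => ?_) (iUnion_subset fun n => sep_subset _ _)
    obtain ⟨n, hn⟩ := (h x hx).exists_gPorousAt_pow
    exact mem_iUnion.2 ⟨n, hx, hn⟩
  rw [hA]
  exact SigmaGPorous.iUnion fun n => sigmaGPorous_three_of_gPorous_pow n _
    fun x hx => hx.2.mono (sep_subset _ _)

theorem GPorousAt.upperPorousAt {X : Type*} [MetricSpace X] {A : Set X} {x : X}
    (h : GPorousAt (fun t => 3 * t) A x) (hx : x ∈ A) : UpperPorousAt A x := by
  have h6 : (0 : ℝ≥0∞) < ENNReal.ofReal (1 / 6) := by norm_num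
  refine h6.trans_le (le_limsup_of_frequently_le ?_ (by isBoundedDefault))
  refine (nhdsGT_basis (0 : ℝ)).frequently_iff.2 fun δ hδ => ?_
  obtain ⟨c, r, hcx, hr, hA, hxc⟩ := gPorousAt_iff.1 h (δ / 2) (half_pos hδ)
  have hrd : r ≤ dist x c := by
    by_contra! hlt
    exact hA.subset ⟨mem_ball.2 hlt, hx⟩
  have hd : 0 < dist x c := hr.trans_le hrd
  rw [dist_comm] at hcx
  refine ⟨2 * dist x c, ⟨by positivity, by linarith⟩, ?_⟩
  have hγ : ENNReal.ofReal r ≤ porosityGamma A x (2 * dist x c) := by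
    refine le_iSup₂_of_le r.toNNReal ⟨c, fun y hy => ?_⟩ le_rfl
    rw [Real.coe_toNNReal r hr.le] at hy
    refine ⟨mem_ball.2 ?_, fun hyA => hA.subset ⟨hy, hyA⟩⟩
    have := dist_triangle y c x
    rw [dist_comm c x] at this
    linarith [mem_ball.1 hy]
  refine (ENNReal.le_div_iff_mul_le (.inl (by simp [dist_pos.1 hd]))
    (.inl ENNReal.ofReal_ne_top)).2 (le_trans ?_ hγ)
  rw [← ENNReal.ofReal_mul (by norm_num)]
  exact ENNReal.ofReal_le_ofReal (by linarith)

/-- A set in a metric space is σ-upper porous iff it is σ-3-porous, i.e. σ-`⟨g⟩`-porous for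
the porosity function `g x = 3 * x`. -/
theorem sigmaUpperPorous_iff_sigmaThreePorous {X : Type*} [MetricSpace X] (A : Set X) :
    SigmaUpperPorous A ↔ SigmaGPorous (fun t : ℝ => 3 * t) A := by
  constructor
  · rintro ⟨B, hB, rfl⟩
    exact SigmaGPorous.iUnion fun n => (hB n).sigmaGPorous_three
  · rintro ⟨B, hB, rfl⟩
    exact ⟨B, fun n x hx => (hB n x hx).upperPorousAt hx, rfl⟩
end
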